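/- Let p ≥ 1, let Φ_1 be a quantum channel (trace-preserving CP map between finite-dimensional matrix algebras) with ν_p(Φ_1) = 1, and let Φ_2 be an arbitrary CP map between finite-dimensional matrix algebras. Then ν_p(Φ_1 ⊗ Φ_2) = ν_p(Φ_1) ν_p(Φ_2) = ν_p(Φ_2). -/

import Mathlib

open Matrix
open scoped ComplexOrder

noncomputable section

/-- A density operator: positive semidefinite with unit trace. -/
def IsDensity {n : Type*} [Fintype n] (ρ : Matrix n n ℂ) : Prop :=
  ρ.PosSemidef ∧ ρ.trace = 1

/-- `Tr σ^p`, defined through the eigenvalues of the Hermitian operator `σ`. -/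
def traceRpow {n : Type*} [Fintype n] [DecidableEq n] (σ : Matrix n n ℂ) (p : ℝ) : ℝ :=
  if h : σ.IsHermitian then ∑ i, (h.eigenvalues i) ^ p else 0

/-- The maximal output `p`-purity `ν_p(Φ)`. -/
def nuP {A B : Type*} [Fintype A] [Fintype B] [DecidableEq B]
    (Φ : Matrix A A ℂ → Matrix B B ℂ) (p : ℝ) : ℝ :=
  sSup {x : ℝ | ∃ ρ : Matrix A A ℂ, IsDensity ρ ∧ x = traceRpow (Φ ρ) p ^ (1 / p)}

/-- A completely positive map of matrix algebras: linear, and positivity is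
preserved by all ampliations `Φ ⊗ Id_n`. -/
def IsCPMap {A B : Type*} [Fintype A] [Fintype B]
    (Φ : Matrix A A ℂ → Matrix B B ℂ) : Prop :=
  IsLinearMap ℂ Φ ∧
    ∀ (n : ℕ) (M : Matrix (A × Fin n) (A × Fin n) ℂ), M.PosSemidef →
      (Matrix.of fun bi bj : B × Fin n =>
        Φ (Matrix.of fun a a' => M (a, bi.2) (a', bj.2)) bi.1 bj.1).PosSemidef

/-- The tensor product `Φ₁ ⊗ Φ₂` of two maps of matrix algebras. -/
def tensorMap {A1 A2 B1 B2 : Type*} [Fintype A1] [Fintype A2]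
    (Φ1 : Matrix A1 A1 ℂ → Matrix B1 B1 ℂ) (Φ2 : Matrix A2 A2 ℂ → Matrix B2 B2 ℂ)
    (M : Matrix (A1 × A2) (A1 × A2) ℂ) : Matrix (B1 × B2) (B1 × B2) ℂ :=
  Matrix.of fun b b' =>
    Φ2 (Matrix.of fun a2 a2' =>
      Φ1 (Matrix.of fun a1 a1' => M (a1, a2) (a1', a2')) b.1 b'.1) b.2 b'.2

section Spectral

variable {m n : Type*} [Fintype m] [Fintype n] [DecidableEq m] [DecidableEq n]

lemma traceRpow_eq_sum_roots {σ : Matrix n n ℂ} (h : σ.IsHermitian) (p : ℝ) :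
    traceRpow σ p = (σ.charpoly.roots.map fun z => z.re ^ p).sum := by
  rw [traceRpow, dif_pos h, h.roots_charpoly_eq_eigenvalues, Multiset.map_map]
  exact Finset.sum_congr rfl fun i _ => by simp

lemma traceRpow_nonneg {σ : Matrix n n ℂ} (h : σ.PosSemidef) (p : ℝ) : 0 ≤ traceRpow σ p := by
  rw [traceRpow, dif_pos h.isHermitian]
  exact Finset.sum_nonneg fun i _ => Real.rpow_nonneg (h.eigenvalues_nonneg i) p

lemma exists_unitary_diagonal {σ : Matrix n n ℂ} (h : σ.PosSemidef) :
    ∃ U ∈ unitary (Matrix n n ℂ), ∃ d : n → ℝ, (∀ i, 0 ≤ d i) ∧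
      σ = U * diagonal (fun i => (d i : ℂ)) * Uᴴ := by
  refine ⟨h.isHermitian.eigenvectorUnitary, h.isHermitian.eigenvectorUnitary.2,
    h.isHermitian.eigenvalues, h.eigenvalues_nonneg, ?_⟩
  exact h.isHermitian.spectral_theorem

lemma traceRpow_unitary_diagonal {U : Matrix n n ℂ} (hU : U ∈ unitary (Matrix n n ℂ))
    (d : n → ℝ) (p : ℝ) :
    traceRpow (U * diagonal (fun i => (d i : ℂ)) * Uᴴ) p = ∑ i, d i ^ p := by
  have hd : (diagonal fun i => (d i : ℂ)).IsHermitian := by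
    rw [IsHermitian, diagonal_conjTranspose]
    congr 1
    ext i
    simp
  rw [traceRpow_eq_sum_roots (isHermitian_mul_mul_conjTranspose U hd), mul_assoc,
    charpoly_mul_comm, mul_assoc, ← star_eq_conjTranspose, Unitary.star_mul_self_of_mem hU,
    mul_one, charpoly_diagonal, Polynomial.roots_prod _ _
      (Finset.prod_ne_zero_iff.2 fun i _ => Polynomial.X_sub_C_ne_zero _)]
  simp

lemma traceRpow_mul_conjTranspose (Y : Matrix m n ℂ) {p : ℝ} (hp : p ≠ 0) :
    traceRpow (Y * Yᴴ) p = traceRpow (Yᴴ * Y) p := by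
  rw [traceRpow_eq_sum_roots (isHermitian_mul_conjTranspose_self Y),
    traceRpow_eq_sum_roots (isHermitian_conjTranspose_mul_self Y)]
  have key := congrArg Polynomial.roots (charpoly_mul_comm' Y Yᴴ)
  have hX : ∀ (k : ℕ), (Polynomial.X ^ k : Polynomial ℂ) ≠ 0 := fun k =>
    pow_ne_zero _ Polynomial.X_ne_zero
  rw [Polynomial.roots_mul (mul_ne_zero (hX _) (charpoly_monic _).ne_zero),
    Polynomial.roots_mul (mul_ne_zero (hX _) (charpoly_monic _).ne_zero)] at key
  have := congrArg (fun s => (Multiset.map (fun z : ℂ => z.re ^ p) s).sum) key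
  simpa [Multiset.map_nsmul, Multiset.sum_nsmul, Real.zero_rpow hp] using this

lemma traceRpow_smul {σ : Matrix n n ℂ} (h : σ.PosSemidef) {c : ℝ} (hc : 0 ≤ c) (p : ℝ) :
    traceRpow ((c : ℂ) • σ) p = c ^ p * traceRpow σ p := by
  obtain ⟨U, hU, d, hd, rfl⟩ := exists_unitary_diagonal h
  have : (c : ℂ) • (U * diagonal (fun i => (d i : ℂ)) * Uᴴ) =
      U * diagonal (fun i => ((c * d i : ℝ) : ℂ)) * Uᴴ := by
    rw [← Matrix.smul_mul, ← Matrix.mul_smul, ← diagonal_smul]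
    congr 3
    ext i
    simp
  rw [this, traceRpow_unitary_diagonal hU, traceRpow_unitary_diagonal hU, Finset.mul_sum]
  exact Finset.sum_congr rfl fun i _ => Real.mul_rpow hc (hd i)

lemma traceRpow_kronecker {σ : Matrix m m ℂ} {τ : Matrix n n ℂ} (hσ : σ.PosSemidef)
    (hτ : τ.PosSemidef) (p : ℝ) :
    traceRpow (kroneckerMap (· * ·) σ τ) p = traceRpow σ p * traceRpow τ p := by
  obtain ⟨U, hU, d, hd, rfl⟩ := exists_unitary_diagonal hσ
  obtain ⟨V, hV, e, he, rfl⟩ := exists_unitary_diagonal hτ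
  have := traceRpow_unitary_diagonal (kronecker_mem_unitary hU hV) (fun i => d i.1 * e i.2) p
  rw [traceRpow_unitary_diagonal hU, traceRpow_unitary_diagonal hV, Finset.sum_mul_sum,
    ← Finset.sum_product', mul_kronecker_mul, mul_kronecker_mul, diagonal_kronecker_diagonal,
    ← conjTranspose_kronecker]
  simp only [Complex.ofReal_mul] at this
  rw [this]
  exact Finset.sum_congr rfl fun i _ => Real.mul_rpow (hd _) (he _)

lemma sum_normSq_row {U : Matrix n n ℂ} (hU : U ∈ unitary (Matrix n n ℂ)) (i : n) :
    ∑ j, Complex.normSq (U i j) = 1 := by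
  have h := congrArg (fun M : Matrix n n ℂ => M i i) (Unitary.mul_star_self_of_mem hU)
  simp only [star_eq_conjTranspose, mul_apply, conjTranspose_apply, one_apply_eq,
    Complex.star_def, Complex.mul_conj] at h
  exact_mod_cast h

lemma sum_normSq_col {U : Matrix n n ℂ} (hU : U ∈ unitary (Matrix n n ℂ)) (j : n) :
    ∑ i, Complex.normSq (U i j) = 1 := by
  simpa using sum_normSq_row (Unitary.star_mem hU) j

/-- Peierls' inequality: pinching to an orthonormal basis does not increase `Tr σ^p`. -/
lemma sum_diag_rpow_le_traceRpow {σ : Matrix n n ℂ} (h : σ.PosSemidef) {U : Matrix n n ℂ}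
    (hU : U ∈ unitary (Matrix n n ℂ)) {p : ℝ} (hp : 1 ≤ p) :
    ∑ i, ((Uᴴ * σ * U) i i).re ^ p ≤ traceRpow σ p := by
  obtain ⟨V, hV, d, hd, rfl⟩ := exists_unitary_diagonal h
  rw [traceRpow_unitary_diagonal hV]
  set W := Uᴴ * V with hW
  have hWu : W ∈ unitary (Matrix n n ℂ) := mul_mem (Unitary.star_mem hU) hV
  have hdiag : ∀ i, ((Uᴴ * (V * diagonal (fun i => (d i : ℂ)) * Vᴴ) * U) i i).re =
      ∑ j, Complex.normSq (W i j) • d j := by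
    intro i
    have : Uᴴ * (V * diagonal (fun i => (d i : ℂ)) * Vᴴ) * U =
        W * diagonal (fun i => (d i : ℂ)) * Wᴴ := by
      simp [hW, Matrix.mul_assoc]
    rw [this, mul_apply, Complex.re_sum]
    refine Finset.sum_congr rfl fun j _ => ?_
    simp [mul_diagonal, Complex.normSq_apply]
    ring
  calc ∑ i, ((Uᴴ * (V * diagonal (fun i => (d i : ℂ)) * Vᴴ) * U) i i).re ^ p
      ≤ ∑ i, ∑ j, Complex.normSq (W i j) • d j ^ p := by
        refine Finset.sum_le_sum fun i _ => ?_
        rw [hdiag]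
        exact (convexOn_rpow hp).map_sum_le (fun j _ => Complex.normSq_nonneg _)
          (sum_normSq_row hWu i) (fun j _ => hd j)
    _ = ∑ j, d j ^ p := by
        rw [Finset.sum_comm]
        refine Finset.sum_congr rfl fun j _ => ?_
        rw [← Finset.sum_smul, sum_normSq_col hWu, one_smul]

/-- The Schatten `p`-norm satisfies the triangle inequality on positive operators. -/
lemma schatten_add_le {σ τ : Matrix n n ℂ} (hσ : σ.PosSemidef) (hτ : τ.PosSemidef)
    {p : ℝ} (hp : 1 ≤ p) :
    traceRpow (σ + τ) p ^ (1 / p) ≤ traceRpow σ p ^ (1 / p) + traceRpow τ p ^ (1 / p) := by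
  obtain ⟨U, hU, d, hd, hU'⟩ := exists_unitary_diagonal (hσ.add hτ)
  have hUU : Uᴴ * U = 1 := Unitary.star_mul_self_of_mem hU
  have hdiag : ∀ i, d i = ((Uᴴ * σ * U) i i).re + ((Uᴴ * τ * U) i i).re := by
    intro i
    have : Uᴴ * σ * U + Uᴴ * τ * U = diagonal (fun i => (d i : ℂ)) := by
      rw [← Matrix.add_mul, ← Matrix.mul_add, hU', Matrix.mul_assoc, Matrix.mul_assoc, hUU,
        Matrix.mul_one, ← Matrix.mul_assoc, hUU, Matrix.one_mul]
    rw [← Complex.add_re, ← Matrix.add_apply, this]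
    simp
  have hnn : ∀ {ω : Matrix n n ℂ}, ω.PosSemidef → ∀ i, 0 ≤ ((Uᴴ * ω * U) i i).re := fun hω i =>
    (Complex.nonneg_iff.1 ((hω.conjTranspose_mul_mul_same U).diag_nonneg (i := i))).1
  have hle : ∀ {ω : Matrix n n ℂ}, ω.PosSemidef →
      (∑ i, ((Uᴴ * ω * U) i i).re ^ p) ^ (1 / p) ≤ traceRpow ω p ^ (1 / p) := fun hω =>
    Real.rpow_le_rpow (Finset.sum_nonneg fun i _ => Real.rpow_nonneg (hnn hω i) p)
      (sum_diag_rpow_le_traceRpow hω hU hp) (by positivity)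
  rw [hU', traceRpow_unitary_diagonal hU]
  simp_rw [hdiag]
  exact (Real.Lp_add_le_of_nonneg _ hp (fun i _ => hnn hσ i) (fun i _ => hnn hτ i)).trans
    (add_le_add (hle hσ) (hle hτ))

lemma schatten_zero {p : ℝ} (hp : p ≠ 0) : traceRpow (0 : Matrix n n ℂ) p ^ (1 / p) = 0 := by
  have h := traceRpow_smul (PosSemidef.zero (n := n) (R := ℂ)) le_rfl p
  rw [smul_zero, Real.zero_rpow hp, zero_mul] at h
  rw [h, Real.zero_rpow (by simpa using hp)]

lemma schatten_sum_le {ι : Type*} (s : Finset ι) {σ : ι → Matrix n n ℂ}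
    (hσ : ∀ i, (σ i).PosSemidef) {p : ℝ} (hp : 1 ≤ p) :
    traceRpow (∑ i ∈ s, σ i) p ^ (1 / p) ≤ ∑ i ∈ s, traceRpow (σ i) p ^ (1 / p) := by
  classical
  induction s using Finset.induction_on with
  | empty => simp only [Finset.sum_empty, schatten_zero (by positivity : p ≠ 0), le_refl]
  | insert a s ha ih =>
    rw [Finset.sum_insert ha, Finset.sum_insert ha]
    exact (schatten_add_le (hσ a) (posSemidef_sum s fun i _ => hσ i) hp).trans
      (add_le_add le_rfl ih)

lemma schatten_smul {σ : Matrix n n ℂ} (h : σ.PosSemidef) {c : ℝ} (hc : 0 ≤ c) {p : ℝ}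
    (hp : p ≠ 0) :
    traceRpow ((c : ℂ) • σ) p ^ (1 / p) = c * traceRpow σ p ^ (1 / p) := by
  rw [traceRpow_smul h hc, Real.mul_rpow (Real.rpow_nonneg hc p) (traceRpow_nonneg h p),
    ← Real.rpow_mul hc, mul_one_div_cancel hp, Real.rpow_one]

end Spectral

section Kraus

variable {A B N E : Type*} [Fintype A] [Fintype B] [Fintype N] [Fintype E]

open scoped MatrixOrder in
lemma Matrix.PosSemidef.exists_eq_mul_conjTranspose {M : Matrix A A ℂ} (hM : M.PosSemidef) :
    ∃ X : Matrix A A ℂ, M = X * Xᴴ := by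
  classical
  exact CStarAlgebra.nonneg_iff_eq_mul_star_self.mp hM.nonneg

lemma Matrix.mul_conjTranspose_eq_sum_vecMulVec {m : Type*} (X : Matrix m E ℂ) :
    X * Xᴴ = ∑ k, vecMulVec (fun i => X i k) (star fun i => X i k) := by
  ext i j
  simp [mul_apply, Matrix.sum_apply, vecMulVec_apply]

lemma IsLinearMap.map_finset_sum {R M M' ι : Type*} [Semiring R] [AddCommMonoid M]
    [AddCommMonoid M'] [Module R M] [Module R M'] {f : M → M'} (hf : IsLinearMap R f)
    (s : Finset ι) (x : ι → M) : f (∑ i ∈ s, x i) = ∑ i ∈ s, f (x i) :=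
  map_sum (hf.mk' f) x s

/-- Complete positivity covers ampliations by an arbitrary finite index type. -/
lemma IsCPMap.posSemidef_ampliation {Φ : Matrix A A ℂ → Matrix B B ℂ} (h : IsCPMap Φ)
    {M : Matrix (A × N) (A × N) ℂ} (hM : M.PosSemidef) :
    (Matrix.of fun b b' : B × N =>
      Φ (Matrix.of fun a a' => M (a, b.2) (a', b'.2)) b.1 b'.1).PosSemidef := by
  let e := Fintype.equivFin N
  convert (h.2 _ _ (hM.submatrix (Prod.map id e.symm))).submatrix (Prod.map id e) using 1
  ext b b'
  simp

/-- The matrix sending an environment vector to the system output of the Stinespring operator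
with coefficients `X` applied to `ψ`. -/
def krausMatrix (X : Matrix (B × A) E ℂ) (ψ : A → ℂ) : Matrix B E ℂ :=
  Matrix.of fun b e => ∑ a, X (b, a) e * ψ a

lemma IsCPMap.exists_kraus [DecidableEq A] {Φ : Matrix A A ℂ → Matrix B B ℂ} (h : IsCPMap Φ) :
    ∃ X : Matrix (B × A) (B × A) ℂ, ∀ ψ φ : A → ℂ,
      Φ (vecMulVec ψ (star φ)) = krausMatrix X ψ * (krausMatrix X φ)ᴴ := by
  let v : A × A → ℂ := fun x => if x.1 = x.2 then 1 else 0
  have hsingle : ∀ i j : A,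
      (Matrix.of fun a a' => vecMulVec v (star v) (a, i) (a', j)) = Matrix.single i j 1 := by
    intro i j
    ext a a'
    simp only [v, of_apply, vecMulVec_apply, Pi.star_apply, single_apply]
    by_cases h1 : a = i <;> by_cases h2 : a' = j <;>
      simp [h1, h2, eq_comm (a := i), eq_comm (a := j)]
  obtain ⟨X, hX⟩ := (h.posSemidef_ampliation
    (posSemidef_vecMulVec_self_star v)).exists_eq_mul_conjTranspose
  have hchoi : ∀ a a' b b', Φ (Matrix.single a a' 1) b b' =
      ∑ e, X (b, a) e * star (X (b', a') e) := by
    intro a a' b b'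
    have := congrArg (fun M : Matrix (B × A) (B × A) ℂ => M (b, a) (b', a')) hX
    simpa only [of_apply, hsingle, mul_apply, conjTranspose_apply] using this
  refine ⟨X, fun ψ φ => ?_⟩
  have hdec : vecMulVec ψ (star φ) =
      ∑ a, ∑ a', (ψ a * star (φ a')) • Matrix.single a a' (1 : ℂ) := by
    conv_lhs => rw [matrix_eq_sum_single (vecMulVec ψ (star φ))]
    simp [vecMulVec_apply]
  ext b b'
  simp only [hdec, h.1.map_finset_sum, h.1.map_smul, Matrix.sum_apply, Matrix.smul_apply,
    smul_eq_mul, hchoi]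
  simp only [krausMatrix, mul_apply, conjTranspose_apply, of_apply, star_sum, star_mul',
    Finset.sum_mul_sum]
  simp only [Finset.mul_sum]
  conv_rhs => rw [Finset.sum_comm]
  refine Finset.sum_congr rfl fun a _ => ?_
  conv_rhs => rw [Finset.sum_comm]
  exact Finset.sum_congr rfl fun a' _ => Finset.sum_congr rfl fun e _ => by ring

lemma IsCPMap.posSemidef {Φ : Matrix A A ℂ → Matrix B B ℂ} (h : IsCPMap Φ) {ρ : Matrix A A ℂ}
    (hρ : ρ.PosSemidef) : (Φ ρ).PosSemidef :=
  (h.posSemidef_ampliation (N := Unit) (hρ.submatrix Prod.fst)).submatrix fun b => (b, ())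

lemma IsCPMap.tensorMap_id {Φ : Matrix A A ℂ → Matrix B B ℂ} (h : IsCPMap Φ)
    {M : Matrix (N × A) (N × A) ℂ} (hM : M.PosSemidef) : (tensorMap id Φ M).PosSemidef :=
  (h.posSemidef_ampliation (hM.submatrix Prod.swap)).submatrix Prod.swap

lemma trace_vecMulVec_star_re (ψ : A → ℂ) :
    (vecMulVec ψ (star ψ)).trace.re = ∑ a, Complex.normSq (ψ a) := by
  simp [trace, vecMulVec_apply, Complex.mul_conj]

lemma IsCPMap.exists_trace_le [DecidableEq A] {Φ : Matrix A A ℂ → Matrix B B ℂ}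
    (h : IsCPMap Φ) :
    ∃ C : ℝ, ∀ ρ : Matrix A A ℂ, ρ.PosSemidef → (Φ ρ).trace.re ≤ C * ρ.trace.re := by
  obtain ⟨X, hX⟩ := h.exists_kraus
  refine ⟨∑ b, ∑ e, ∑ a, ‖X (b, a) e‖ ^ 2, fun ρ hρ => ?_⟩
  have hpure : ∀ ψ : A → ℂ, (Φ (vecMulVec ψ (star ψ))).trace.re ≤
      (∑ b, ∑ e, ∑ a, ‖X (b, a) e‖ ^ 2) * (vecMulVec ψ (star ψ)).trace.re := by
    intro ψ
    rw [hX, trace_vecMulVec_star_re]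
    simp only [trace, diag_apply, mul_apply, conjTranspose_apply, Complex.star_def,
      Complex.mul_conj, Complex.re_sum, Complex.ofReal_re, Finset.sum_mul]
    refine Finset.sum_le_sum fun b _ => Finset.sum_le_sum fun e _ => ?_
    simp only [Complex.normSq_eq_norm_sq, krausMatrix, of_apply]
    rw [← Finset.sum_mul]
    calc ‖∑ a, X (b, a) e * ψ a‖ ^ 2 ≤ (∑ a, ‖X (b, a) e‖ * ‖ψ a‖) ^ 2 := by
          gcongr
          exact (norm_sum_le _ _).trans_eq (by simp)
      _ ≤ _ := Finset.sum_mul_sq_le_sq_mul_sq _ _ _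
  obtain ⟨Y, rfl⟩ := hρ.exists_eq_mul_conjTranspose
  rw [mul_conjTranspose_eq_sum_vecMulVec]
  rw [h.1.map_finset_sum, trace_sum, trace_sum, Complex.re_sum, Complex.re_sum, Finset.mul_sum]
  exact Finset.sum_le_sum fun k _ => hpure _

lemma IsCPMap.nuP_nonneg [DecidableEq B] {Φ : Matrix A A ℂ → Matrix B B ℂ} (h : IsCPMap Φ)
    (p : ℝ) : 0 ≤ nuP Φ p := by
  refine Real.sSup_nonneg ?_
  rintro x ⟨ρ, hρ, rfl⟩
  exact Real.rpow_nonneg (traceRpow_nonneg (h.posSemidef hρ.1) p) _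

end Kraus

section OutputPurity

variable {A B N : Type*} [Fintype A] [Fintype B] [Fintype N]
  [DecidableEq A] [DecidableEq B] [DecidableEq N] {Φ : Matrix A A ℂ → Matrix B B ℂ} {p : ℝ}

lemma schatten_le_card_mul_trace {σ : Matrix B B ℂ} (h : σ.PosSemidef) (hp : 1 ≤ p) :
    traceRpow σ p ^ (1 / p) ≤ (Fintype.card B : ℝ) ^ (1 / p) * σ.trace.re := by
  have hp0 : p ≠ 0 := by positivity
  have htr : σ.trace.re = ∑ i, h.isHermitian.eigenvalues i := by
    rw [h.isHermitian.trace_eq_sum_eigenvalues]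
    simp
  have hnn : 0 ≤ σ.trace.re := htr ▸ Finset.sum_nonneg fun i _ => h.eigenvalues_nonneg i
  have hle : traceRpow σ p ≤ Fintype.card B * σ.trace.re ^ p := by
    rw [traceRpow, dif_pos h.isHermitian, ← nsmul_eq_mul]
    refine Finset.sum_le_card_nsmul _ _ _ fun i _ => ?_
    refine Real.rpow_le_rpow (h.eigenvalues_nonneg i) ?_ (by positivity)
    rw [htr]
    exact Finset.single_le_sum (fun j _ => h.eigenvalues_nonneg j) (Finset.mem_univ i)
  calc traceRpow σ p ^ (1 / p) ≤ (Fintype.card B * σ.trace.re ^ p) ^ (1 / p) :=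
        Real.rpow_le_rpow (traceRpow_nonneg h p) hle (by positivity)
    _ = _ := by
        rw [Real.mul_rpow (by positivity) (Real.rpow_nonneg hnn p), ← Real.rpow_mul hnn,
          mul_one_div_cancel hp0, Real.rpow_one]

lemma IsCPMap.bddAbove (h : IsCPMap Φ) (hp : 1 ≤ p) :
    BddAbove {x : ℝ | ∃ ρ : Matrix A A ℂ, IsDensity ρ ∧ x = traceRpow (Φ ρ) p ^ (1 / p)} := by
  obtain ⟨C, hC⟩ := h.exists_trace_le
  refine ⟨(Fintype.card B : ℝ) ^ (1 / p) * C, ?_⟩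
  rintro x ⟨ρ, ⟨hρ, htr⟩, rfl⟩
  refine (schatten_le_card_mul_trace (h.posSemidef hρ) hp).trans ?_
  have := hC ρ hρ
  rw [htr, Complex.one_re, mul_one] at this
  gcongr

lemma IsCPMap.schatten_le_nuP_mul_trace (h : IsCPMap Φ) (hp : 1 ≤ p) {ρ : Matrix A A ℂ}
    (hρ : ρ.PosSemidef) : traceRpow (Φ ρ) p ^ (1 / p) ≤ nuP Φ p * ρ.trace.re := by
  have hp0 : p ≠ 0 := by positivity
  obtain ⟨htr, him⟩ := Complex.nonneg_iff.1 hρ.trace_nonneg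
  have htrace : ρ.trace = (ρ.trace.re : ℂ) := Complex.ext rfl (by simp [← him])
  rcases htr.eq_or_lt with h0 | hpos
  · have : ρ = 0 := by
      rw [← hρ.trace_eq_zero_iff, htrace, ← h0, Complex.ofReal_zero]
    rw [this, h.1.map_zero, schatten_zero hp0]
    simp
  · set t := ρ.trace.re
    have ht : (t : ℂ) ≠ 0 := by exact_mod_cast hpos.ne'
    have hps : (((t⁻¹ : ℝ) : ℂ) • ρ).PosSemidef := hρ.smul (by
      rw [Complex.zero_le_real]; positivity)
    have hden : IsDensity (((t⁻¹ : ℝ) : ℂ) • ρ) := by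
      refine ⟨hps, ?_⟩
      rw [trace_smul, htrace, smul_eq_mul, Complex.ofReal_inv, inv_mul_cancel₀ ht]
    have hscale : ρ = (t : ℂ) • (((t⁻¹ : ℝ) : ℂ) • ρ) := by
      rw [smul_smul, Complex.ofReal_inv, mul_inv_cancel₀ ht, one_smul]
    have hle : traceRpow (Φ (((t⁻¹ : ℝ) : ℂ) • ρ)) p ^ (1 / p) ≤ nuP Φ p :=
      le_csSup (h.bddAbove hp) ⟨_, hden, rfl⟩
    rw [hscale, h.1.map_smul, schatten_smul (h.posSemidef hps) hpos.le hp0, mul_comm]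
    gcongr

/-- For a pure input, `(Id ⊗ Φ)(ψψ*)` is isospectral, up to zeros, to a sum of complementary
outputs of the slices of `ψ`. -/
lemma IsCPMap.schatten_tensorMap_id_pure_le (h : IsCPMap Φ) (hp : 1 ≤ p) (ψ : N × A → ℂ) :
    traceRpow (tensorMap id Φ (vecMulVec ψ (star ψ))) p ^ (1 / p) ≤
      nuP Φ p * (vecMulVec ψ (star ψ)).trace.re := by
  have hp0 : p ≠ 0 := by positivity
  obtain ⟨X, hX⟩ := h.exists_kraus
  let φ : N → A → ℂ := fun i a => ψ (i, a)
  let Y : Matrix (N × B) (B × A) ℂ := Matrix.of fun x e => krausMatrix X (φ x.1) x.2 e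
  have hY : tensorMap id Φ (vecMulVec ψ (star ψ)) = Y * Yᴴ := by
    ext x x'
    exact congrArg (fun M : Matrix B B ℂ => M x.2 x'.2) (hX (φ x.1) (φ x'.1))
  have hYY : Yᴴ * Y = ∑ i, (krausMatrix X (φ i))ᴴ * krausMatrix X (φ i) := by
    ext e e'
    simp [Y, mul_apply, Matrix.sum_apply, Fintype.sum_prod_type]
  have htr : (vecMulVec ψ (star ψ)).trace.re = ∑ i, (vecMulVec (φ i) (star (φ i))).trace.re := by
    simp only [trace_vecMulVec_star_re, Fintype.sum_prod_type, φ]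
  rw [hY, traceRpow_mul_conjTranspose _ hp0, hYY, htr, Finset.mul_sum]
  refine (schatten_sum_le _ (fun i => posSemidef_conjTranspose_mul_self _) hp).trans
    (Finset.sum_le_sum fun i _ => ?_)
  rw [← traceRpow_mul_conjTranspose _ hp0, ← hX]
  exact h.schatten_le_nuP_mul_trace hp (posSemidef_vecMulVec_self_star _)

lemma IsCPMap.schatten_tensorMap_id_le (h : IsCPMap Φ) (hp : 1 ≤ p)
    {ρ : Matrix (N × A) (N × A) ℂ} (hρ : ρ.PosSemidef) :
    traceRpow (tensorMap id Φ ρ) p ^ (1 / p) ≤ nuP Φ p * ρ.trace.re := by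
  obtain ⟨Y, rfl⟩ := hρ.exists_eq_mul_conjTranspose
  rw [mul_conjTranspose_eq_sum_vecMulVec]
  set P : N × A → Matrix (N × A) (N × A) ℂ :=
    fun k => vecMulVec (fun i => Y i k) (star fun i => Y i k)
  have hsum : tensorMap id Φ (∑ k, P k) = ∑ k, tensorMap id Φ (P k) := by
    ext x x'
    have harg : (Matrix.of fun a a' => (∑ k, P k) (x.1, a) (x'.1, a')) =
        ∑ k, Matrix.of fun a a' => P k (x.1, a) (x'.1, a') := by
      ext a a'
      simp [Matrix.sum_apply]
    rw [Matrix.sum_apply]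
    simp only [tensorMap, id, of_apply]
    rw [harg, h.1.map_finset_sum, Matrix.sum_apply]
  rw [hsum, trace_sum, Complex.re_sum, Finset.mul_sum]
  exact (schatten_sum_le _
      (fun k => h.tensorMap_id (posSemidef_vecMulVec_self_star _)) hp).trans
    (Finset.sum_le_sum fun k _ => h.schatten_tensorMap_id_pure_le hp _)

end OutputPurity

section Tensor

variable {A1 B1 A2 B2 : Type*} [Fintype A1] [Fintype A2]
  {Φ1 : Matrix A1 A1 ℂ → Matrix B1 B1 ℂ} {Φ2 : Matrix A2 A2 ℂ → Matrix B2 B2 ℂ}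

lemma tensorMap_kronecker (h1 : IsLinearMap ℂ Φ1) (h2 : IsLinearMap ℂ Φ2)
    (ρ1 : Matrix A1 A1 ℂ) (ρ2 : Matrix A2 A2 ℂ) :
    tensorMap Φ1 Φ2 (kroneckerMap (· * ·) ρ1 ρ2) = kroneckerMap (· * ·) (Φ1 ρ1) (Φ2 ρ2) := by
  ext x x'
  have hin : ∀ a2 a2', (Matrix.of fun a1 a1' =>
      kroneckerMap (· * ·) ρ1 ρ2 (a1, a2) (a1', a2')) = ρ2 a2 a2' • ρ1 := by
    intro a2 a2'
    ext a1 a1'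
    simp [mul_comm]
  have hout : (Matrix.of fun a2 a2' => (ρ2 a2 a2' • Φ1 ρ1) x.1 x'.1) =
      Φ1 ρ1 x.1 x'.1 • ρ2 := by
    ext a2 a2'
    simp [mul_comm]
  simp only [tensorMap, hin, h1.map_smul, of_apply]
  rw [hout, h2.map_smul]
  simp

/-- A channel acting on one factor maps density operators to density operators. -/
lemma IsDensity.tensorMap_id_right [Fintype B1] (h1 : IsCPMap Φ1)
    (h1tp : ∀ ρ, (Φ1 ρ).trace = ρ.trace) {ρ : Matrix (A1 × A2) (A1 × A2) ℂ} (hρ : IsDensity ρ) :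
    IsDensity (tensorMap Φ1 id ρ : Matrix (B1 × A2) (B1 × A2) ℂ) := by
  refine ⟨h1.posSemidef_ampliation hρ.1, ?_⟩
  rw [← hρ.2]
  simp only [trace, diag_apply, tensorMap, of_apply, id, Fintype.sum_prod_type]
  rw [Finset.sum_comm, Finset.sum_comm (γ := A1)]
  exact Finset.sum_congr rfl fun a2 _ => h1tp (Matrix.of fun a1 a1' => ρ (a1, a2) (a1', a2))

end Tensor

/-- If `Φ₁` is a channel with `ν_p(Φ₁) = 1` and `Φ₂` is an arbitrary CP map,
then `ν_p(Φ₁ ⊗ Φ₂) = ν_p(Φ₁) ν_p(Φ₂) = ν_p(Φ₂)`. -/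
theorem nuP_multiplicative_of_nuP_one
    {A1 B1 A2 B2 : Type*} [Fintype A1] [Fintype B1] [Fintype A2] [Fintype B2]
    [DecidableEq A1] [DecidableEq B1] [DecidableEq A2] [DecidableEq B2]
    (p : ℝ) (hp : 1 ≤ p)
    (Φ1 : Matrix A1 A1 ℂ → Matrix B1 B1 ℂ)
    (h1cp : IsCPMap Φ1) (h1tp : ∀ ρ, (Φ1 ρ).trace = ρ.trace)
    (h1nu : nuP Φ1 p = 1)
    (Φ2 : Matrix A2 A2 ℂ → Matrix B2 B2 ℂ) (h2cp : IsCPMap Φ2) :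
    nuP (tensorMap Φ1 Φ2) p = nuP Φ1 p * nuP Φ2 p ∧
      nuP (tensorMap Φ1 Φ2) p = nuP Φ2 p := by
  suffices h : nuP (tensorMap Φ1 Φ2) p = nuP Φ2 p by
    rw [h1nu, one_mul]
    exact ⟨h, h⟩
  have hupper : ∀ x ∈ {x : ℝ | ∃ ρ : Matrix (A1 × A2) (A1 × A2) ℂ, IsDensity ρ ∧
      x = traceRpow (tensorMap Φ1 Φ2 ρ) p ^ (1 / p)}, x ≤ nuP Φ2 p := by
    rintro x ⟨ρ, hρ, rfl⟩
    have hρ' := hρ.tensorMap_id_right h1cp h1tp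
    have hle := h2cp.schatten_tensorMap_id_le hp hρ'.1
    rwa [hρ'.2, Complex.one_re, mul_one] at hle
  refine le_antisymm (Real.sSup_le hupper (h2cp.nuP_nonneg p)) ?_
  have hprod : ∀ ρ1 ρ2, IsDensity ρ1 → IsDensity ρ2 →
      traceRpow (Φ1 ρ1) p ^ (1 / p) * traceRpow (Φ2 ρ2) p ^ (1 / p) ≤
        nuP (tensorMap Φ1 Φ2) p := by
    intro ρ1 ρ2 h1 h2
    refine le_csSup ⟨_, hupper⟩ ⟨kroneckerMap (· * ·) ρ1 ρ2, ⟨h1.1.kronecker h2.1, ?_⟩, ?_⟩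
    · rw [trace_kronecker, h1.2, h2.2, one_mul]
    · have hp1 := h1cp.posSemidef h1.1
      have hp2 := h2cp.posSemidef h2.1
      rw [tensorMap_kronecker h1cp.1 h2cp.1, traceRpow_kronecker hp1 hp2,
        Real.mul_rpow (traceRpow_nonneg hp1 p) (traceRpow_nonneg hp2 p)]
  have hnonneg : 0 ≤ nuP (tensorMap Φ1 Φ2) p := by
    refine Real.sSup_nonneg ?_
    rintro x ⟨ρ, hρ, rfl⟩
    exact Real.rpow_nonneg
      (traceRpow_nonneg (h2cp.tensorMap_id (hρ.tensorMap_id_right h1cp h1tp).1) p) _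
  refine Real.sSup_le ?_ hnonneg
  rintro y ⟨ρ2, h2, rfl⟩
  set y := traceRpow (Φ2 ρ2) p ^ (1 / p)
  have hy : 0 ≤ y := Real.rpow_nonneg (traceRpow_nonneg (h2cp.posSemidef h2.1) p) _
  rcases hy.eq_or_lt with hy0 | hypos
  · exact hy0 ▸ hnonneg
  have hdiv : nuP Φ1 p ≤ nuP (tensorMap Φ1 Φ2) p / y := by
    refine Real.sSup_le ?_ (div_nonneg hnonneg hy)
    rintro x ⟨ρ1, h1, rfl⟩
    rw [le_div_iff₀ hypos]
    exact hprod ρ1 ρ2 h1 h2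
  rwa [h1nu, le_div_iff₀ hypos, one_mul] at hdiv
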